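/- arXiv:1501.06831 — 2 statements merged into one kernel-verified Lean document; each statement's English description precedes it below -/
import Mathlib

section
/- Let PSL₂(ℤ) be the quotient of the special linear group SL(2,ℤ) by its center, and let Γ = ℤ × PSL₂(ℤ). There exist a nonempty finite alphabet A and a finite set L of patterns over Γ such that the subshift of finite type X = {x : Γ → A | for all g ∈ Γ, g·x disagrees with every pattern in L} is nonempty and Stab(x) = {1} for every x ∈ X (a strongly aperiodic SFT on ℤ × PSL₂(ℤ)). -/
/-- `PSL₂(ℤ)`: the quotient of `SL(2,ℤ)` by its center `{±I}`. -/
abbrev PSL2Z : Type :=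
  Matrix.SpecialLinearGroup (Fin 2) ℤ ⧸
    Subgroup.center (Matrix.SpecialLinearGroup (Fin 2) ℤ)

/-- The shift action of a group `Γ` on configurations: `(g • x) h = x (g⁻¹ h)`. -/
def Shift {Γ A : Type*} [Group Γ] (g : Γ) (x : Γ → A) : Γ → A :=
  fun h => x (g⁻¹ * h)

/-- The stabilizer of a configuration under the shift action. -/
def Stab {Γ A : Type*} [Group Γ] (x : Γ → A) : Set Γ :=
  {g | Shift g x = x}

/-- The SFT on `Γ` determined by a set `L` of patterns over `Γ` (a pattern being a finite
domain `D ⊆ Γ` together with a word on it): the configurations `x : Γ → A` all of whose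
shifts `g • x` disagree with every pattern of `L`. -/
def SFT {Γ A : Type*} [Group Γ] (L : Set (Finset Γ × (Γ → A))) : Set (Γ → A) :=
  {x | ∀ g : Γ, ∀ w ∈ L, ∃ k ∈ w.1, Shift g x k ≠ w.2 k}


/-- Two points coalesce under `p` if their forward orbits under `p` meet. -/
def Coalesce {α : Type*} (p : α → α) (u v : α) : Prop :=
  ∃ k l : ℕ, p^[k] u = p^[l] v

namespace Coalesce

variable {α : Type*} {p : α → α} {u v w : α}

theorem symm (h : Coalesce p u v) : Coalesce p v u := by
  obtain ⟨k, l, h⟩ := h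
  exact ⟨l, k, h.symm⟩

theorem trans (h : Coalesce p u v) (h' : Coalesce p v w) : Coalesce p u w := by
  obtain ⟨k, l, h⟩ := h
  obtain ⟨m, n, h'⟩ := h'
  refine ⟨m + k, l + n, ?_⟩
  rw [Function.iterate_add_apply, h, ← Function.iterate_add_apply, add_comm,
    Function.iterate_add_apply, h', ← Function.iterate_add_apply]

/-- A self-map whose orbits all meet a given injective orbit admits a level function. -/
theorem exists_level (hp : ∀ v, Coalesce p v u)
    (hu : Function.Injective fun k : ℕ => p^[k] u) :
    ∃ ℓ : α → ℤ, ∀ v, ℓ (p v) = ℓ v + 1 := by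
  choose k l h using hp
  refine ⟨fun v => l v - k v, fun v => ?_⟩
  have key : p^[l (p v) + k v] u = p^[l v + k (p v) + 1] u := by
    calc p^[l (p v) + k v] u = p^[k v] (p^[k (p v)] (p v)) := by
          rw [add_comm, Function.iterate_add_apply, h]
      _ = p^[k (p v) + 1] (p^[k v] v) := by
          rw [← Function.iterate_succ_apply p, ← Function.iterate_add_apply,
            ← Function.iterate_add_apply]
          congr 1
          omega
      _ = p^[l v + k (p v) + 1] u := by
          rw [h, ← Function.iterate_add_apply]
          congr 1
          omega
  have := hu key
  push_cast
  omega

end Coalesce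

section Parent

variable {G : Type*} [Group G] {a b : G} {e : G → ZMod 3}

/-- The parent of `h`: move to the exit `h * b ^ e h` of the triangle of `h`, and cross the
`a`-edge there. -/
def parent (a b : G) (e : G → ZMod 3) (h : G) : G :=
  h * (b ^ (e h).val * a)

/-- `e` points, in each triangle `{h, h * b, h * b ^ 2}`, to a single exit, and each edge
`{h, h * a}` contains exactly one exit. -/
structure IsOrientation (a b : G) (e : G → ZMod 3) : Prop where
  triangle : ∀ h, e (h * b) = e h - 1
  edge : ∀ h, e h = 0 ↔ e (h * a) ≠ 0

theorem parent_mul_left {g : G} (he : ∀ h, e (g * h) = e h) (h : G) :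
    parent a b e (g * h) = g * parent a b e h := by
  simp only [parent, he, mul_assoc]

theorem iterate_parent_mul_left {g : G} (he : ∀ h, e (g * h) = e h) (k : ℕ) (h : G) :
    (parent a b e)^[k] (g * h) = g * (parent a b e)^[k] h := by
  induction k with
  | zero => rfl
  | succ k ih => rw [Function.iterate_succ_apply', ih, parent_mul_left he,
      Function.iterate_succ_apply']

namespace IsOrientation

theorem parent_mul_b (H : IsOrientation a b e) (hb : b ^ 3 = 1) (h : G) :
    parent a b e (h * b) = parent a b e h := by
  have key : ∀ z : ZMod 3, b * b ^ (z - 1).val = b ^ z.val := by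
    intro z
    fin_cases z
    · change b * b ^ 2 = b ^ 0
      rw [← pow_succ', hb, pow_zero]
    · change b * b ^ 0 = b ^ 1
      simp
    · change b * b ^ 1 = b ^ 2
      rw [← pow_succ']
  rw [parent, parent, H.triangle, mul_assoc h b, ← mul_assoc b, key]

theorem parent_of_eq_zero {h : G} (he : e h = 0) : parent a b e h = h * a := by
  simp [parent, he]

theorem coalesce_mul_a (H : IsOrientation a b e) (ha : a ^ 2 = 1) (h : G) :
    Coalesce (parent a b e) h (h * a) := by
  by_cases he : e h = 0
  · exact ⟨1, 0, parent_of_eq_zero he⟩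
  · have he' : e (h * a) = 0 := by
      by_contra hne
      exact he ((H.edge h).2 hne)
    refine ⟨0, 1, ?_⟩
    simp [parent_of_eq_zero he', mul_assoc, ← pow_two, ha]

theorem coalesce (H : IsOrientation a b e) (ha : a ^ 2 = 1) (hb : b ^ 3 = 1)
    (hab : Subgroup.closure {a, b} = ⊤) (g h : G) : Coalesce (parent a b e) g h := by
  have key : ∀ s ∈ Subgroup.closure {a, b}, ∀ u, Coalesce (parent a b e) u (u * s) := by
    intro s hs
    induction hs using Subgroup.closure_induction with
    | mem s hs =>
      intro u
      rcases hs with rfl | rfl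
      · exact H.coalesce_mul_a ha u
      · exact ⟨1, 1, (H.parent_mul_b hb u).symm⟩
    | one => exact fun u => ⟨0, 0, by simp⟩
    | mul s t _ _ ihs iht =>
      intro u
      rw [← mul_assoc]
      exact (ihs u).trans (iht _)
    | inv s _ ihs =>
      intro u
      simpa using (ihs (u * s⁻¹)).symm
  simpa using key (g⁻¹ * h) (hab ▸ Subgroup.mem_top _) g

end IsOrientation

end Parent

section Coboundary

/-- `f` is the difference sequence of a bounded sequence. -/
def IsBoundedDifference (f : ℤ → ℤ) : Prop :=
  ∃ F : ℤ → ℤ, (∃ C, ∀ i, |F i| ≤ C) ∧ ∀ i, f i = F (i + 1) - F i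

namespace IsBoundedDifference

variable {f g : ℤ → ℤ}

theorem add (hf : IsBoundedDifference f) (hg : IsBoundedDifference g) :
    IsBoundedDifference fun i => f i + g i := by
  obtain ⟨F, ⟨C, hC⟩, hF⟩ := hf
  obtain ⟨G, ⟨D, hD⟩, hG⟩ := hg
  exact ⟨fun i => F i + G i, ⟨C + D, fun i => (abs_add_le _ _).trans (add_le_add (hC i) (hD i))⟩,
    fun i => by simp only [hF, hG]; ring⟩

theorem const_mul (c : ℤ) (hf : IsBoundedDifference f) :
    IsBoundedDifference fun i => c * f i := by
  obtain ⟨F, ⟨C, hC⟩, hF⟩ := hf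
  exact ⟨fun i => c * F i, ⟨|c| * C, fun i => by
    rw [abs_mul]; exact mul_le_mul_of_nonneg_left (hC i) (abs_nonneg c)⟩,
    fun i => by simp only [hF]; ring⟩

theorem shift_sub (hf : ∃ C, ∀ i, |f i| ≤ C) (n : ℤ) :
    IsBoundedDifference fun i => f (i + n) - f i := by
  obtain ⟨C, hC⟩ := hf
  have step (m : ℤ) : IsBoundedDifference fun i => f (i + (m + 1)) - f (i + m) :=
    ⟨fun i => f (i + m), ⟨C, fun i => hC _⟩, fun i => by
      simp only; rw [add_right_comm i 1 m, add_assoc]⟩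
  induction n using Int.induction_on with
  | zero => exact ⟨0, ⟨0, by simp⟩, by simp⟩
  | succ n ih => convert ih.add (step n) using 2; ring
  | pred n ih =>
    convert ih.add ((step (-n - 1)).const_mul (-1)) using 2
    rw [sub_add_cancel]
    ring

theorem not_of_one_le (hf : ∀ i, 1 ≤ f i) : ¬ IsBoundedDifference f := by
  rintro ⟨F, ⟨C, hC⟩, hF⟩
  have grow (N : ℕ) : F 0 + N ≤ F N := by
    induction N with
    | zero => simp
    | succ N ih =>
      have h1 := hF N
      have h2 := hf N
      push_cast
      linarith
  have h1 := grow (2 * C + 1).toNat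
  have h2 := abs_le.1 (hC 0)
  have h3 := abs_le.1 (hC (2 * C + 1).toNat)
  have h4 := Int.self_le_toNat (2 * C + 1)
  linarith [h2.1, h3.2]

theorem not_const_mul {c : ℤ} (hc : c ≠ 0) (hf : ∀ i, 1 ≤ f i) :
    ¬ IsBoundedDifference fun i => c * f i := by
  intro h
  refine not_of_one_le (fun i => ?_) (h.const_mul c)
  have : 1 ≤ c * c := by have := mul_self_pos.2 hc; omega
  nlinarith [hf i]

end IsBoundedDifference

theorem two_pow_ne_three_pow {s t : ℕ} (h : 0 < s + t) : (2 : ℤ) ^ s ≠ 3 ^ t := by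
  intro heq
  rcases Nat.eq_zero_or_pos s with rfl | hs
  · have ht : t ≠ 0 := by omega
    have : (1 : ℤ) < 3 ^ t := one_lt_pow₀ (by norm_num) ht
    simp_all
  · have h1 : Even ((2 : ℤ) ^ s) := (even_two).pow_of_ne_zero hs.ne'
    have h2 : Odd ((3 : ℤ) ^ t) := Odd.pow (by decide)
    rw [heq] at h1
    exact (Int.not_even_iff_odd.2 h2) h1

end Coboundary

section Tiling

/-- The symbols of the tiling: the position of the exit in the triangle, a digit, a carry, and a
flag telling by which of `2` and `1 / 3` the row is multiplied to give the row of its parent. -/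
abbrev Tile : Type :=
  ZMod 3 × Set.Icc (1 : ℤ) 6 × Set.Icc (-1 : ℤ) 2 × Bool

namespace Tile

def exitPos (t : Tile) : ZMod 3 := t.1
def digit (t : Tile) : ℤ := t.2.1
def carry (t : Tile) : ℤ := t.2.2.1
def flag (t : Tile) : Bool := t.2.2.2

theorem one_le_digit (t : Tile) : 1 ≤ t.digit := t.2.1.2.1

theorem abs_digit_le (t : Tile) : |t.digit| ≤ 6 :=
  abs_le.2 ⟨by have := t.one_le_digit; omega, t.2.1.2.2⟩

theorem abs_carry_le (t : Tile) : |t.carry| ≤ 2 :=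
  abs_le.2 ⟨le_trans (by norm_num) t.2.2.1.2.1, t.2.2.1.2.2⟩

end Tile

/-- Numerator of the multiplier attached to a flag. -/
def multNum (m : Bool) : ℤ := if m then 2 else 1

/-- Denominator of the multiplier attached to a flag. -/
def multDen (m : Bool) : ℤ := if m then 1 else 3

variable {G : Type*} [Group G] {a b : G}

/-- The local rules: exits and flags are constant on the rows `ℤ × {h}`, exits define an
orientation, and digits and carries perform the multiplication of each row by its multiplier,
with result the row of the parent. -/
structure IsTiling (a b : G) (x : ℤ → G → Tile) : Prop where
  exit_succ : ∀ i h, (x (i + 1) h).exitPos = (x i h).exitPos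
  flag_succ : ∀ i h, (x (i + 1) h).flag = (x i h).flag
  orientation : ∀ i, IsOrientation a b fun h => (x i h).exitPos
  carry_succ : ∀ i h, multNum (x i h).flag * (x i h).digit + (x i h).carry =
    multDen (x i h).flag * (x i (parent a b (fun h => (x i h).exitPos) h)).digit +
      (x (i + 1) h).carry

theorem Function.eq_apply_zero_of_forall_succ {β : Type*} {f : ℤ → β} (h : ∀ i, f (i + 1) = f i)
    (i : ℤ) : f i = f 0 := by
  induction i using Int.induction_on with
  | zero => rfl
  | succ i ih => rw [h, ih]
  | pred i ih => rw [← ih, ← h, sub_add_cancel]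

namespace IsTiling

variable {x : ℤ → G → Tile}

theorem exit_eq (H : IsTiling a b x) (i : ℤ) (h : G) : (x i h).exitPos = (x 0 h).exitPos :=
  Function.eq_apply_zero_of_forall_succ (f := fun i => (x i h).exitPos) (fun i => H.exit_succ i h) i

theorem flag_eq (H : IsTiling a b x) (i : ℤ) (h : G) : (x i h).flag = (x 0 h).flag :=
  Function.eq_apply_zero_of_forall_succ (f := fun i => (x i h).flag) (fun i => H.flag_succ i h) i

/-- Up to a bounded difference, the row of the `k`-th ancestor of `h` is `2 ^ s / 3 ^ t` times the
row of `h`, for some `s + t = k`. -/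
theorem exists_mult (H : IsTiling a b x) (h : G) (k : ℕ) :
    ∃ s t : ℕ, s + t = k ∧ IsBoundedDifference fun i => 2 ^ s * (x i h).digit -
      3 ^ t * (x i ((parent a b fun h => (x 0 h).exitPos)^[k] h)).digit := by
  induction k with
  | zero => exact ⟨0, 0, rfl, 0, ⟨0, by simp⟩, by simp⟩
  | succ k ih =>
    obtain ⟨s, t, rfl, hst⟩ := ih
    simp only [Function.iterate_succ_apply']
    set u := (parent a b fun h => (x 0 h).exitPos)^[s + t] h
    have hu : IsBoundedDifference fun i => multNum (x 0 u).flag * (x i u).digit -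
        multDen (x 0 u).flag * (x i (parent a b (fun h => (x 0 h).exitPos) u)).digit := by
      refine ⟨fun i => (x i u).carry, ⟨2, fun i => Tile.abs_carry_le _⟩, fun i => ?_⟩
      have := H.carry_succ i u
      simp only [H.exit_eq i, H.flag_eq i] at this
      simp only
      linarith
    cases hm : (x 0 u).flag
    · refine ⟨s, t + 1, by ring, ?_⟩
      convert hst.add (hu.const_mul (3 ^ t)) using 2
      simp only [hm, multNum, multDen]
      norm_num
      ring
    · refine ⟨s + 1, t, by ring, ?_⟩
      convert (hst.const_mul 2).add (hu.const_mul (3 ^ t)) using 2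
      simp only [hm, multNum, multDen]
      norm_num
      ring

/-- No row has the same digits as a row of one of its proper ancestors, even up to translation. -/
theorem not_digit_eq (H : IsTiling a b x) (h : G) {k : ℕ} (hk : 0 < k) (n : ℤ) :
    ¬ ∀ i, (x i ((parent a b fun h => (x 0 h).exitPos)^[k] h)).digit = (x (i + n) h).digit := by
  intro heq
  obtain ⟨s, t, hst, hd⟩ := H.exists_mult h k
  refine IsBoundedDifference.not_const_mul (c := 2 ^ s - 3 ^ t)
    (sub_ne_zero.2 (two_pow_ne_three_pow (hst ▸ hk))) (fun i => (x i h).one_le_digit) ?_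
  have hs := IsBoundedDifference.shift_sub (f := fun i => (x i h).digit)
    ⟨6, fun i => Tile.abs_digit_le _⟩ n
  convert hd.add (hs.const_mul (3 ^ t)) using 2
  rw [heq]
  ring

theorem eq_zero_of_periodic (H : IsTiling a b x) {n : ℕ}
    (hn : ∀ i h, x (i + n) h = x i h) : n = 0 := by
  by_contra hn0
  have : NeZero n := ⟨hn0⟩
  obtain ⟨k, l, hkl, heq⟩ := Finite.exists_ne_map_eq_of_infinite
    fun (k : ℕ) (j : Fin n) => x j ((parent a b fun h => (x 0 h).exitPos)^[k] 1)
  wlog hlt : k < l generalizing k l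
  · exact this l k hkl.symm heq.symm (by omega)
  obtain ⟨m, rfl⟩ := Nat.exists_eq_add_of_lt hlt
  have hmod (i : ℤ) (h : G) : x i h = x (i % n) h := by
    have hper : Function.Periodic (fun i => x i h) (n : ℤ) := fun i => hn i h
    have := hper.sub_zsmul_eq (x := i) (i / n)
    rw [smul_eq_mul, mul_comm, ← Int.emod_def] at this
    exact this.symm
  refine H.not_digit_eq ((parent a b fun h => (x 0 h).exitPos)^[k] 1) (Nat.succ_pos m) 0 fun i => ?_
  have hi : i % n < n := Int.emod_lt_of_pos _ (by omega)
  have hi' : 0 ≤ i % n := Int.emod_nonneg _ (by omega)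
  have := congrFun heq ⟨(i % n).toNat, by omega⟩
  simp only [Int.toNat_of_nonneg hi'] at this
  rw [← Function.iterate_add_apply, add_zero, hmod i, hmod i, this]
  congr 3
  omega

theorem eq_one_of_period (H : IsTiling a b x) (ha : a ^ 2 = 1) (hb : b ^ 3 = 1)
    (hab : Subgroup.closure {a, b} = ⊤) {n : ℤ} {g : G}
    (hg : ∀ i h, x (i + n) (g * h) = x i h) : n = 0 ∧ g = 1 := by
  set p := parent a b fun h => (x 0 h).exitPos with hp
  have hiter := iterate_parent_mul_left (a := a) (b := b) (e := fun h => (x 0 h).exitPos) (g := g)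
    fun h => by rw [← H.exit_eq (0 + n), hg]
  obtain ⟨k, l, hkl⟩ := (H.orientation 0).coalesce ha hb hab 1 g
  rw [← mul_one g, hiter] at hkl
  rcases lt_trichotomy k l with hlt | rfl | hlt
  · exfalso
    obtain ⟨m, rfl⟩ := Nat.exists_eq_add_of_lt hlt
    refine H.not_digit_eq (p^[k] 1) (Nat.succ_pos m) n fun i => ?_
    rw [← hg i, ← Function.iterate_add_apply, hkl,
      show m.succ + k = k + m + 1 by omega]
  · have hg1 : g = 1 := by simpa using hkl.symm
    subst hg1
    simp only [one_mul] at hg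
    refine ⟨?_, rfl⟩
    rcases Int.natAbs_eq n with hn | hn
    · rw [hn] at hg
      rw [hn, H.eq_zero_of_periodic hg, Nat.cast_zero]
    · rw [hn, H.eq_zero_of_periodic (n := n.natAbs) fun i h => ?_, Nat.cast_zero, neg_zero]
      rw [← hg (i + n.natAbs), hn]
      simp
  · exfalso
    obtain ⟨m, rfl⟩ := Nat.exists_eq_add_of_lt hlt
    refine H.not_digit_eq (p^[l] 1) (Nat.succ_pos m) (-n) fun i => ?_
    rw [← hg (i + -n), ← Function.iterate_add_apply, ← hkl, neg_add_cancel_right,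
      show m.succ + l = l + m + 1 by omega]

end IsTiling

/-- Doubling modulo powers of `6` has a two-sided orbit in `[1, 6)`. -/
theorem exists_orbit : ∃ y : ℤ → ℚ, (∀ k, 1 ≤ y k ∧ y k < 6) ∧
    ∀ k, ∃ m : Bool, multNum m * y k = multDen m * y (k + 1) := by
  let y : ℤ → ℚ := fun k => 2 ^ k / 6 ^ Int.log 6 ((2 : ℚ) ^ k)
  have hy : ∀ k, 1 ≤ y k ∧ y k < 6 := by
    intro k
    have h2 : (0 : ℚ) < 2 ^ k := by positivity
    have h6 : (0 : ℚ) < 6 ^ Int.log 6 ((2 : ℚ) ^ k) := by positivity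
    have h1 := Int.zpow_log_le_self (b := 6) (by norm_num) h2
    have h3 := Int.lt_zpow_succ_log_self (b := 6) (by norm_num) ((2 : ℚ) ^ k)
    push_cast at h1 h3
    rw [zpow_add_one₀ (by norm_num)] at h3
    constructor
    · rwa [one_le_div h6]
    · rw [div_lt_iff₀ h6]
      linarith
  refine ⟨y, hy, fun k => ?_⟩
  obtain ⟨j, hj⟩ : ∃ j : ℤ, Int.log 6 ((2 : ℚ) ^ (k + 1)) = Int.log 6 ((2 : ℚ) ^ k) + j :=
    ⟨_, (add_sub_cancel _ _).symm⟩
  have hrel : y (k + 1) * 6 ^ j = 2 * y k := by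
    simp only [y, hj]
    rw [zpow_add₀ (by norm_num) _ j, zpow_add_one₀ (by norm_num) k]
    field_simp
  obtain ⟨h1, h2⟩ := hy k
  obtain ⟨h3, h4⟩ := hy (k + 1)
  have hj0 : 0 ≤ j := by
    by_contra hneg
    have : (6 : ℚ) ^ j ≤ 6 ^ (-1 : ℤ) := zpow_le_zpow_right₀ (by norm_num) (by omega)
    norm_num at this
    nlinarith
  have hj1 : j ≤ 1 := by
    by_contra hneg
    have : (6 : ℚ) ^ (2 : ℤ) ≤ 6 ^ j := zpow_le_zpow_right₀ (by norm_num) (by omega)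
    norm_num at this
    nlinarith
  obtain rfl | rfl : j = 0 ∨ j = 1 := by omega
  · refine ⟨true, ?_⟩
    norm_num at hrel
    norm_num [multNum, multDen]
    linarith
  · refine ⟨false, ?_⟩
    norm_num at hrel
    norm_num [multNum, multDen]
    linarith

theorem beatty_digit_mem {y : ℚ} (hy : 1 ≤ y ∧ y < 6) (i : ℤ) :
    ⌊((i + 1 : ℤ) : ℚ) * y⌋ - ⌊(i : ℚ) * y⌋ ∈ Set.Icc (1 : ℤ) 6 := by
  have e : ((i + 1 : ℤ) : ℚ) * y = i * y + y := by push_cast; ring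
  rw [e]
  have h1 := Int.floor_le ((i : ℚ) * y)
  have h2 := Int.lt_floor_add_one ((i : ℚ) * y)
  have h3 := Int.floor_le ((i : ℚ) * y + y)
  have h4 := Int.lt_floor_add_one ((i : ℚ) * y + y)
  constructor
  · have : (0 : ℚ) < ((⌊(i : ℚ) * y + y⌋ - ⌊(i : ℚ) * y⌋ : ℤ) : ℚ) := by
      push_cast; linarith
    have := Int.cast_pos.1 this
    omega
  · have : ((⌊(i : ℚ) * y + y⌋ - ⌊(i : ℚ) * y⌋ : ℤ) : ℚ) < (7 : ℤ) := by
      push_cast; linarith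
    have := Int.cast_lt.1 this
    omega

theorem beatty_carry_mem {y z : ℚ} {m : Bool} (h : multNum m * y = multDen m * z) (i : ℤ) :
    multNum m * ⌊(i : ℚ) * y⌋ - multDen m * ⌊(i : ℚ) * z⌋ ∈ Set.Icc (-1 : ℤ) 2 := by
  have h1 := Int.floor_le ((i : ℚ) * y)
  have h2 := Int.lt_floor_add_one ((i : ℚ) * y)
  have h3 := Int.floor_le ((i : ℚ) * z)
  have h4 := Int.lt_floor_add_one ((i : ℚ) * z)
  have h5 : (multNum m : ℚ) * (i * y) = multDen m * (i * z) := by linear_combination (i : ℚ) * h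
  generalize (i : ℚ) * y = u at *
  generalize (i : ℚ) * z = v at *
  suffices h6 : ((-2 : ℤ) : ℚ) < ((multNum m * ⌊u⌋ - multDen m * ⌊v⌋ : ℤ) : ℚ) ∧
      ((multNum m * ⌊u⌋ - multDen m * ⌊v⌋ : ℤ) : ℚ) < (3 : ℤ) by
    have h7 := Int.cast_lt.1 h6.1
    have h8 := Int.cast_lt.1 h6.2
    constructor <;> omega
  cases m <;> norm_num [multNum, multDen] at h5 ⊢ <;> constructor <;> linarith

theorem exists_isTiling {e : G → ZMod 3} (he : IsOrientation a b e) {ℓ : G → ℤ}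
    (hℓ : ∀ h, ℓ (parent a b e h) = ℓ h + 1) : ∃ x, IsTiling a b x := by
  obtain ⟨y, hy, hm⟩ := exists_orbit
  choose m hm using hm
  refine ⟨fun i h => (e h, ⟨_, beatty_digit_mem (hy (ℓ h)) i⟩,
    ⟨_, beatty_carry_mem (hm (ℓ h)) i⟩, m (ℓ h)), fun _ _ => rfl, fun _ _ => rfl, fun _ => he,
    fun i h => ?_⟩
  simp only [Tile.exitPos, Tile.digit, Tile.carry, Tile.flag, hℓ]
  ring

end Tiling

section LocalRules

theorem shift_apply {Γ A : Type*} [Group Γ] (g : Γ) (x : Γ → A) (h : Γ) :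
    Shift g x h = x (g⁻¹ * h) :=
  rfl

/-- A shift-invariant condition read off a finite window is an SFT. -/
theorem exists_finite_mem_SFT_iff {Γ A : Type*} [Group Γ] [Finite A] (W : Finset Γ)
    (R : (Γ → A) → Prop) (hR : ∀ x y, (∀ k ∈ W, x k = y k) → R x → R y) :
    ∃ L : Set (Finset Γ × (Γ → A)), L.Finite ∧ ∀ x, x ∈ SFT L ↔ ∀ g, R fun k => x (g * k) := by
  classical
  rcases isEmpty_or_nonempty A with hA | ⟨⟨c⟩⟩
  · exact ⟨∅, Set.finite_empty, fun x => (hA.false (x 1)).elim⟩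
  let extend : (W → A) → Γ → A := fun u k => if hk : k ∈ W then u ⟨k, hk⟩ else c
  have hext : ∀ u : Γ → A, ∀ k ∈ W, extend (fun k => u k) k = u k := fun u k hk => dif_pos hk
  refine ⟨(fun u => (W, extend u)) '' {u | ¬ R (extend u)}, (Set.toFinite _).image _,
    fun x => ⟨fun hx g => ?_, ?_⟩⟩
  · by_contra hg
    obtain ⟨k, hk, hne⟩ := hx g⁻¹ _ ⟨fun k => x (g * k), fun h => hg (hR _ _ (hext _) h), rfl⟩
    exact hne (by simp only [shift_apply, inv_inv]; exact (hext (fun k => x (g * k)) k hk).symm)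
  · rintro hx g _ ⟨u, hu, rfl⟩
    by_contra! hall
    exact hu (hR _ _ hall (hx g⁻¹))

variable {G : Type*} [Group G]

/-- The rules of `IsTiling` at the origin of `ℤ × G`. -/
def IsLocalTiling (a b : G) (y : Multiplicative ℤ × G → Tile) : Prop :=
  (y (.ofAdd 1, 1)).exitPos = (y 1).exitPos ∧
  (y (.ofAdd 1, 1)).flag = (y 1).flag ∧
  (y (1, b)).exitPos = (y 1).exitPos - 1 ∧
  ((y 1).exitPos = 0 ↔ (y (1, a)).exitPos ≠ 0) ∧
  multNum (y 1).flag * (y 1).digit + (y 1).carry =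
    multDen (y 1).flag * (y (1, b ^ (y 1).exitPos.val * a)).digit + (y (.ofAdd 1, 1)).carry

theorem isTiling_iff (a b : G) (y : Multiplicative ℤ × G → Tile) :
    IsTiling a b (fun i h => y (.ofAdd i, h)) ↔ ∀ g, IsLocalTiling a b fun k => y (g * k) := by
  constructor
  · rintro H ⟨i, h⟩
    have := H.carry_succ i.toAdd h
    have h1 := (H.orientation i.toAdd).triangle h
    have h2 := (H.orientation i.toAdd).edge h
    refine ⟨?_, ?_, ?_, ?_, ?_⟩
    · simpa using H.exit_succ i.toAdd h
    · simpa using H.flag_succ i.toAdd h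
    · simpa using h1
    · simpa using h2
    · simpa [parent] using this
  · intro H
    refine ⟨fun i h => ?_, fun i h => ?_, fun i => ⟨fun h => ?_, fun h => ?_⟩, fun i h => ?_⟩
    · simpa using (H (.ofAdd i, h)).1
    · simpa using (H (.ofAdd i, h)).2.1
    · simpa using (H (.ofAdd i, h)).2.2.1
    · simpa using (H (.ofAdd i, h)).2.2.2.1
    · simpa [parent] using (H (.ofAdd i, h)).2.2.2.2

/-- `ℤ × G` has a strongly aperiodic SFT as soon as `G` is generated by elements `a`, `b` with
`a ^ 2 = b ^ 3 = 1` and carries an orientation with a level function. -/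
theorem exists_strongly_aperiodic {a b : G} (ha : a ^ 2 = 1) (hb : b ^ 3 = 1)
    (hab : Subgroup.closure {a, b} = ⊤) {e : G → ZMod 3} (he : IsOrientation a b e) {ℓ : G → ℤ}
    (hℓ : ∀ h, ℓ (parent a b e h) = ℓ h + 1) :
    ∃ (m : ℕ) (_ : 0 < m)
      (L : Set (Finset (Multiplicative ℤ × G) × ((Multiplicative ℤ × G) → Fin m))),
      L.Finite ∧ (SFT L).Nonempty ∧
        ∀ x ∈ SFT L, Stab x = ({1} : Set (Multiplicative ℤ × G)) := by
  classical
  let f : Tile ≃ Fin (Fintype.card Tile) := Fintype.equivFin Tile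
  obtain ⟨x₀, hx₀⟩ := exists_isTiling he hℓ
  let W : Finset (Multiplicative ℤ × G) :=
    {1, (.ofAdd 1, 1), (1, b), (1, a)} ∪
      Finset.univ.image fun z : ZMod 3 => (1, b ^ z.val * a)
  obtain ⟨L, hL, hmem⟩ := exists_finite_mem_SFT_iff W
    (fun y : _ → Fin (Fintype.card Tile) => IsLocalTiling a b fun k => f.symm (y k)) <| by
      intro y z hyz hy
      have h1 := hyz 1 (by simp [W])
      have h2 := hyz (.ofAdd 1, 1) (by simp [W])
      have h3 := hyz (1, b) (by simp [W])
      have h4 := hyz (1, a) (by simp [W])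
      have h5 : ∀ j : ZMod 3, y (1, b ^ j.val * a) = z (1, b ^ j.val * a) := fun j =>
        hyz _ (Finset.mem_union_right _ (Finset.mem_image_of_mem _ (Finset.mem_univ j)))
      simpa only [IsLocalTiling, h1, h2, h3, h4, h5] using hy
  have hmem' (x : Multiplicative ℤ × G → Fin (Fintype.card Tile)) :
      x ∈ SFT L ↔ IsTiling a b fun i h => f.symm (x (.ofAdd i, h)) :=
    (hmem x).trans (isTiling_iff a b fun k => f.symm (x k)).symm
  refine ⟨Fintype.card Tile, Fin.pos (f (x₀ 0 1)), L, hL,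
    ⟨fun k => f (x₀ k.1.toAdd k.2), (hmem' _).2 (by simpa using hx₀)⟩, fun x hx => ?_⟩
  ext ⟨n, g⟩
  constructor
  · intro hstab
    obtain ⟨hn, hg⟩ := ((hmem' x).1 hx).eq_one_of_period ha hb hab (n := n.toAdd) (g := g) <| by
      intro i h
      have : Shift (n, g) x (.ofAdd (i + n.toAdd), g * h) = x (.ofAdd (i + n.toAdd), g * h) :=
        congrFun hstab _
      rw [← this, shift_apply]
      simp
    rw [Set.mem_singleton_iff, Prod.mk_eq_one]
    exact ⟨Multiplicative.toAdd.injective hn, hg⟩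
  · intro h1
    rw [Set.mem_singleton_iff.1 h1]
    funext h
    simp [shift_apply]

end LocalRules

section Modular

open Matrix Matrix.SpecialLinearGroup ModularGroup
open scoped MatrixGroups

/-- The projection `SL(2, ℤ) → PSL₂(ℤ)`. -/
def toPSL : SL(2, ℤ) →* PSL2Z :=
  QuotientGroup.mk' _

theorem toPSL_eq_iff {M N : SL(2, ℤ)} : toPSL M = toPSL N ↔ N = M ∨ N = -M := by
  have hc (C : SL(2, ℤ)) : C ∈ Subgroup.center SL(2, ℤ) ↔ C = 1 ∨ C = -1 := by
    rw [mem_center_iff]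
    constructor
    · rintro ⟨r, hr, hC⟩
      rw [Fintype.card_fin, sq_eq_one_iff] at hr
      rcases hr with rfl | rfl
      · left; ext i j; rw [← hC]; fin_cases i <;> fin_cases j <;> simp
      · right; ext i j; rw [← hC]; fin_cases i <;> fin_cases j <;> simp
    · rintro (rfl | rfl)
      · exact ⟨1, by simp, by ext i j; fin_cases i <;> fin_cases j <;> simp⟩
      · exact ⟨-1, by simp, by ext i j; fin_cases i <;> fin_cases j <;> simp⟩
  change (M : PSL2Z) = N ↔ _
  rw [QuotientGroup.eq, hc, inv_mul_eq_iff_eq_mul, inv_mul_eq_iff_eq_mul, mul_one, mul_neg_one]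

theorem toPSL_surjective : Function.Surjective toPSL :=
  QuotientGroup.mk'_surjective _

/-- The exit of the triangle of a matrix with bottom row `(c, d)`. -/
def exitOfRow (c d : ℤ) : ZMod 3 :=
  if c * d < 0 ∨ d = 0 then 0 else if d * (d - c) < 0 ∨ d = c then 1 else 2

theorem exitOfRow_neg (c d : ℤ) : exitOfRow (-c) (-d) = exitOfRow c d := by
  simp only [exitOfRow, neg_mul_neg, neg_eq_zero, neg_inj,
    show -d * (-d - -c) = d * (d - c) by ring]

theorem exitOfRow_triangle {c d : ℤ} (h : c ≠ 0 ∨ d ≠ 0) :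
    exitOfRow d (d - c) = exitOfRow c d - 1 := by
  have e3 : (d - c) * (d - c - d) < 0 ↔ 0 < (d - c) * c := by
    rw [show (d - c) * (d - c - d) = -((d - c) * c) by ring, neg_lt_zero]
  simp only [exitOfRow, e3]
  simp only [mul_neg_iff, mul_pos_iff]
  split_ifs <;> first | rfl | (exfalso; omega)

theorem exitOfRow_edge {c d : ℤ} (h : c ≠ 0 ∨ d ≠ 0) :
    exitOfRow c d = 0 ↔ exitOfRow d (-c) ≠ 0 := by
  have key (c d : ℤ) : exitOfRow c d = 0 ↔ c * d < 0 ∨ d = 0 := by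
    unfold exitOfRow
    split_ifs with h1 h2
    · simp [h1]
    · simp [h1]
    · simp only [h1, iff_false]; decide
  rw [Ne, key, key]
  simp only [mul_neg_iff]
  omega

/-- The orientation of `PSL₂(ℤ)` towards the cusp `∞`. -/
noncomputable def modularExit (g : PSL2Z) : ZMod 3 :=
  exitOfRow ((Function.surjInv toPSL_surjective g).1 1 0)
    ((Function.surjInv toPSL_surjective g).1 1 1)

theorem modularExit_toPSL (M : SL(2, ℤ)) : modularExit (toPSL M) = exitOfRow (M.1 1 0) (M.1 1 1) := by
  have key (N : SL(2, ℤ)) (h : toPSL N = toPSL M) :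
      exitOfRow (N.1 1 0) (N.1 1 1) = exitOfRow (M.1 1 0) (M.1 1 1) := by
    rcases toPSL_eq_iff.1 h with rfl | rfl
    · rfl
    · simp only [coe_neg, Matrix.neg_apply, exitOfRow_neg]
  exact key _ (Function.surjInv_eq toPSL_surjective (toPSL M))

theorem bottom_row_ne_zero (M : SL(2, ℤ)) : M.1 1 0 ≠ 0 ∨ M.1 1 1 ≠ 0 := by
  by_contra! h
  have := M.2
  rw [det_fin_two, h.1, h.2] at this
  simp at this

theorem isOrientation_modularExit : IsOrientation (toPSL S) (toPSL (S * T)) modularExit := by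
  constructor
  · intro h
    obtain ⟨M, rfl⟩ := toPSL_surjective h
    rw [← map_mul, modularExit_toPSL, modularExit_toPSL,
      ← exitOfRow_triangle (bottom_row_ne_zero M)]
    congr 1
    · simp [coe_S, coe_T, Matrix.mul_apply, Fin.sum_univ_two]
    · simp [coe_S, coe_T, Matrix.mul_apply, Fin.sum_univ_two]
      ring
  · intro h
    obtain ⟨M, rfl⟩ := toPSL_surjective h
    rw [← map_mul, modularExit_toPSL, modularExit_toPSL, exitOfRow_edge (bottom_row_ne_zero M)]
    simp [coe_S, Matrix.mul_apply, Fin.sum_univ_two]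

theorem toPSL_S_sq : toPSL S ^ 2 = 1 := by
  rw [← map_pow, ← map_one toPSL, toPSL_eq_iff]
  right
  ext i j
  fin_cases i <;> fin_cases j <;> simp [coe_S, pow_two]

theorem toPSL_S_mul_T_pow : toPSL (S * T) ^ 3 = 1 := by
  rw [← map_pow, ← map_one toPSL, toPSL_eq_iff]
  right
  ext i j
  fin_cases i <;> fin_cases j <;> simp [coe_S, coe_T, pow_succ]

theorem closure_toPSL : Subgroup.closure {toPSL S, toPSL (S * T)} = ⊤ := by
  have hS : toPSL S ∈ Subgroup.closure {toPSL S, toPSL (S * T)} :=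
    Subgroup.subset_closure (by simp)
  have hT : toPSL T ∈ Subgroup.closure {toPSL S, toPSL (S * T)} := by
    have : toPSL T = (toPSL S)⁻¹ * toPSL (S * T) := by simp
    rw [this]
    exact mul_mem (inv_mem hS) (Subgroup.subset_closure (by simp))
  rw [eq_top_iff, ← MonoidHom.range_eq_top.2 toPSL_surjective, MonoidHom.range_eq_map,
    ← SpecialLinearGroup.SL2Z_generators, MonoidHom.map_closure, Subgroup.closure_le]
  rintro _ ⟨_, rfl | rfl, rfl⟩
  exacts [hS, hT]

theorem iterate_parent_one (k : ℕ) :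
    (parent (toPSL S) (toPSL (S * T)) modularExit)^[k] 1 = toPSL (T ^ (-k : ℤ)) := by
  induction k with
  | zero => simp
  | succ k ih =>
    have he : modularExit (toPSL (T ^ (-k : ℤ))) = 2 := by
      rw [modularExit_toPSL, coe_T_zpow]
      exact (by decide : exitOfRow 0 1 = 2)
    have hinv : toPSL (S * T) ^ 2 * toPSL S = toPSL T⁻¹ := by
      have h1 : toPSL (S * T) ^ 2 = (toPSL (S * T))⁻¹ :=
        eq_inv_of_mul_eq_one_left (by rw [← pow_succ, toPSL_S_mul_T_pow])
      rw [h1]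
      simp
    rw [Function.iterate_succ_apply', ih, parent, he, show (2 : ZMod 3).val = 2 from rfl, hinv,
      ← map_mul]
    congr 1
    rw [← _root_.zpow_sub_one]
    congr 1
    push_cast
    ring

theorem injective_iterate_parent_one :
    Function.Injective fun k : ℕ => (parent (toPSL S) (toPSL (S * T)) modularExit)^[k] 1 := by
  intro k l hkl
  simp only [iterate_parent_one, toPSL_eq_iff] at hkl
  rcases hkl with h | h
  · have := congrArg (fun N : SL(2, ℤ) => N.1 0 1) h
    simp only [coe_T_zpow] at this
    simp at this
    omega
  · have := congrArg (fun N : SL(2, ℤ) => N.1 0 0) h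
    simp only [coe_neg, Matrix.neg_apply, coe_T_zpow] at this
    simp at this

end Modular

/-- There is a strongly aperiodic SFT on `ℤ × PSL₂(ℤ)`: a nonempty finite alphabet
`Fin m` and a finite set `L` of patterns over `Γ = ℤ × PSL₂(ℤ)` whose SFT `X` is nonempty
with `Stab(x) = {1}` for every `x ∈ X`. -/
theorem stmt_18 :
    ∃ (m : ℕ) (_ : 0 < m)
      (L : Set (Finset (Multiplicative ℤ × PSL2Z) ×
        ((Multiplicative ℤ × PSL2Z) → Fin m))),
      L.Finite ∧ (SFT L).Nonempty ∧
        ∀ x ∈ SFT L, Stab x = ({1} : Set (Multiplicative ℤ × PSL2Z)) := by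
  obtain ⟨ℓ, hℓ⟩ := Coalesce.exists_level
    (fun g => isOrientation_modularExit.coalesce toPSL_S_sq toPSL_S_mul_T_pow closure_toPSL g 1)
    injective_iterate_parent_one
  exact exists_strongly_aperiodic toPSL_S_sq toPSL_S_mul_T_pow closure_toPSL
    isOrientation_modularExit hℓ
end

section
/- Let G be an infinite finitely generated subgroup of GL_k(ℚ) whose image in GL_k(ℝ) is bounded (equivalently, has compact closure in GL_k(ℝ)). Let Γ = ℤ × G. Then there exist a nonempty finite alphabet A and a finite set L of patterns over Γ such that the subshift of finite type X = {x : Γ → A | for all g ∈ Γ, g·x disagrees with every pattern in L} is nonempty and Stab(x) = {1} for every x ∈ X (a strongly aperiodic SFT on ℤ × G). -/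
open scoped Matrix.Norms.Operator

/-- A stabilizer is unchanged by relabelling the alphabet. -/
theorem stab_equiv_comp {Γ A B : Type*} [Group Γ] (e : A ≃ B) (x : Γ → A) :
    Stab (e ∘ x) = Stab x := by
  ext g
  constructor
  · intro h
    funext γ
    exact e.injective (congrFun h γ)
  · intro h
    funext γ
    exact congrArg e (congrFun h γ)

/-- Configurations over a finite alphabet given by a local rule form an SFT. -/
theorem exists_sft_of_local_rule {Γ A : Type*} [Group Γ] [Finite A] [Nonempty A]
    (F : Finset Γ) (P : (Γ → A) → Prop)
    (hP : ∀ y y' : Γ → A, (∀ d ∈ F, y d = y' d) → P y → P y') :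
    ∃ (m : ℕ) (_ : 0 < m) (e : A ≃ Fin m) (L : Set (Finset Γ × (Γ → Fin m))),
      L.Finite ∧ ∀ x : Γ → A, (e ∘ x ∈ SFT L ↔ ∀ g, P (Shift g x)) := by
  classical
  obtain ⟨m, ⟨e⟩⟩ := Finite.exists_equiv_fin A
  let z : Fin m := e (Classical.arbitrary A)
  refine ⟨m, z.pos, e, {F} ×ˢ {w | (∀ γ, γ ∉ F → w γ = z) ∧ ¬ P (e.symm ∘ w)}, ?_, ?_⟩
  · refine (Set.finite_singleton F).prod ?_
    refine Set.Finite.subset (s := {w : Γ → Fin m | ∀ γ, γ ∉ F → w γ = z}) ?_ fun w h => h.1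
    have hinj : Function.Injective
        (fun (w : {w : Γ → Fin m | ∀ γ, γ ∉ F → w γ = z}) (d : F) => w.1 d) := by
      intro w w' h
      ext γ : 2
      by_cases hγ : γ ∈ F
      · exact congrFun h ⟨γ, hγ⟩
      · rw [w.2 γ hγ, w'.2 γ hγ]
    exact Finite.of_injective _ hinj
  · intro x
    constructor
    · intro hx g
      by_contra hg
      obtain ⟨d, hd, hne⟩ := hx g (F, fun γ => if γ ∈ F then e (Shift g x γ) else z)
        ⟨rfl, fun γ hγ => by simp [hγ], fun h => hg (hP _ _ (fun d hd => by simp [hd]) h)⟩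
      exact hne (by simp only at hd; simp [hd, Shift])
    · rintro hx g ⟨F', w⟩ ⟨hF, -, hw⟩
      obtain rfl : F' = F := hF
      by_contra! hcon
      refine hw (hP _ _ (fun d hd => ?_) (hx g))
      exact e.injective (by simpa [Shift] using hcon d hd)

/-- A function on `ℤ` is a finite coboundary if it is the difference of a function of finite
range and its translate. -/
def IsFiniteCoboundary {V : Type*} [AddCommGroup V] (f : ℤ → V) : Prop :=
  ∃ u : ℤ → V, (Set.range u).Finite ∧ ∀ i, f i = u (i + 1) - u i

namespace IsFiniteCoboundary

theorem zero {V : Type*} [AddCommGroup V] : IsFiniteCoboundary (fun _ => (0 : V)) :=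
  ⟨fun _ => 0, Set.finite_range_const, by simp⟩

theorem add {V : Type*} [AddCommGroup V] {f g : ℤ → V} (hf : IsFiniteCoboundary f)
    (hg : IsFiniteCoboundary g) : IsFiniteCoboundary (fun i => f i + g i) := by
  obtain ⟨u, hu, hfu⟩ := hf
  obtain ⟨v, hv, hgv⟩ := hg
  refine ⟨fun i => u i + v i, (hu.add hv).subset ?_, fun i => ?_⟩
  · rintro _ ⟨i, rfl⟩
    exact Set.add_mem_add ⟨i, rfl⟩ ⟨i, rfl⟩
  · simp only [hfu, hgv]; abel

theorem map {V W : Type*} [AddCommGroup V] [AddCommGroup W] (φ : V →+ W) {f : ℤ → V}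
    (hf : IsFiniteCoboundary f) : IsFiniteCoboundary (fun i => φ (f i)) := by
  obtain ⟨u, hu, hfu⟩ := hf
  refine ⟨fun i => φ (u i), ?_, fun i => by simp only [hfu, map_sub]⟩
  exact (hu.image φ).subset (by rintro _ ⟨i, rfl⟩; exact ⟨_, ⟨i, rfl⟩, rfl⟩)

theorem mul_left {R : Type*} [Ring R] (r : R) {f : ℤ → R}
    (hf : IsFiniteCoboundary f) : IsFiniteCoboundary (fun i => r * f i) :=
  hf.map (AddMonoidHom.mulLeft r)

theorem translate_sub {V : Type*} [AddCommGroup V] {f : ℤ → V} (hf : (Set.range f).Finite)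
    (n : ℤ) : IsFiniteCoboundary (fun i => f (i + n) - f i) := by
  have key (m : ℤ) : IsFiniteCoboundary (fun i => f (i + (m + 1)) - f (i + m)) :=
    ⟨fun i => f (i + m), hf.subset (by rintro _ ⟨i, rfl⟩; exact ⟨_, rfl⟩), fun i => by
      simp only [add_assoc, add_comm 1 m]⟩
  induction n using Int.induction_on with
  | zero => simpa using zero
  | succ n ih => convert ih.add (key n) using 2; abel
  | pred n ih =>
    convert ih.add ((key (-n - 1)).map (-AddMonoidHom.id V)) using 2
    simp

end IsFiniteCoboundary

/-- If `R * f` is a finite coboundary and `f` stays close to the invertible `q • m`, then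
`R = 0`. -/
theorem eq_zero_of_isFiniteCoboundary_mul {E : Type*} [NormedRing E] [NormedAlgebra ℚ E]
    {R m m' : E} (hmm : m * m' = 1)
    {K b : ℝ} (hm' : ‖m'‖ ≤ K) {q : ℕ} (hq : K * b < q) {f : ℤ → E}
    (hf : ∀ i, ‖f i - (q : E) * m‖ ≤ b) (hR : IsFiniteCoboundary (fun i => R * f i)) :
    R = 0 := by
  obtain ⟨u, hu, hfu⟩ := hR
  replace hfu : ∀ i, R * f i = u (i + 1) - u i := hfu
  obtain ⟨C, hC⟩ := hu.isBounded.exists_norm_le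
  have hsum (N : ℕ) : R * ∑ i ∈ Finset.range N, f i = u N - u 0 := by
    induction N with
    | zero => simp
    | succ N ih => rw [Finset.sum_range_succ, mul_add, ih, hfu]; push_cast; abel
  have hclose (N : ℕ) : ‖∑ i ∈ Finset.range N, f i - (N : E) * ((q : E) * m)‖ ≤ N * b := by
    have : ∑ i ∈ Finset.range N, f i - (N : E) * ((q : E) * m)
        = ∑ i ∈ Finset.range N, (f i - (q : E) * m) := by simp
    rw [this]
    refine (norm_sum_le_of_le (f := fun i : ℕ => f i - (q : E) * m) _ fun i _ => hf i).trans ?_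
    simp
  have hbound (N : ℕ) : N * ((q - K * b) * ‖R * m‖) ≤ 2 * C := by
    set S := ∑ i ∈ Finset.range N, f i
    have h1 : ((N * q : ℕ) : ℚ) • (R * m)
        = R * S - R * m * (m' * (S - (N : E) * ((q : E) * m))) := by
      have h2 : R * m * (m' * (S - (N : E) * ((q : E) * m)))
          = R * (m * m') * (S - (N : E) * ((q : E) * m)) := by noncomm_ring
      rw [h2, hmm, mul_one, mul_sub, sub_sub_cancel, Nat.cast_smul_eq_nsmul, nsmul_eq_mul,
        ← mul_assoc (N : E), ← Nat.cast_mul, ← mul_assoc, ← mul_assoc,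
        (Nat.cast_commute (N * q) R).eq]
    have h2 : ‖((N * q : ℕ) : ℚ) • (R * m)‖ = N * q * ‖R * m‖ := by
      rw [norm_smul, ← Rat.norm_cast_real]; simp
    have h3 : ‖R * S‖ ≤ 2 * C := by
      rw [hsum]
      have := norm_sub_le (u N) (u 0)
      linarith [hC _ ⟨N, rfl⟩, hC _ ⟨0, rfl⟩]
    have h4 : ‖R * m * (m' * (S - (N : E) * ((q : E) * m)))‖ ≤ ‖R * m‖ * (K * (N * b)) := by
      refine (norm_mul_le _ _).trans (mul_le_mul_of_nonneg_left ?_ (norm_nonneg _))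
      exact (norm_mul_le _ _).trans
        (mul_le_mul hm' (hclose N) (norm_nonneg _) ((norm_nonneg _).trans hm'))
    have h5 := norm_sub_le (R * S) (R * m * (m' * (S - (N : E) * ((q : E) * m))))
    rw [← h1, h2] at h5
    linarith
  have hRm : R * m = 0 := by
    by_contra hne
    have hpos : 0 < (q - K * b) * ‖R * m‖ := mul_pos (by linarith) (norm_pos_iff.2 hne)
    obtain ⟨N, hN⟩ := exists_nat_gt (2 * C / ((q - K * b) * ‖R * m‖))
    rw [div_lt_iff₀ hpos] at hN
    linarith [hbound N]
  calc R = R * m * m' := by rw [mul_assoc, hmm, mul_one]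
    _ = 0 := by rw [hRm, zero_mul]

/-- Suppose that the row of `y` over `h` encodes the element `ρ h⁻¹ * v` of a ring, up to a
finite coboundary. If `G` acts freely on `v`, then `y` has trivial stabilizer. -/
theorem stab_eq_one_of_isFiniteCoboundary {G A E : Type*} [Group G] [Infinite G] [Finite A]
    [Ring E] (ρ : G →* E) (hρ : Function.Injective ρ) {S : Set G}
    (hS : Subgroup.closure S = ⊤) (δ : A → E) (y : Multiplicative ℤ × G → A)
    (hrule : ∀ s ∈ S, ∀ h, IsFiniteCoboundary fun i : ℤ =>
      δ (y (Multiplicative.ofAdd i, h * s)) - ρ s⁻¹ * δ (y (Multiplicative.ofAdd i, h)))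
    (hfree : ∀ R : E, IsFiniteCoboundary
      (fun i : ℤ => R * δ (y (Multiplicative.ofAdd i, 1))) → R = 0) :
    Stab y = {1} := by
  have hall (g : G) : ∀ h, IsFiniteCoboundary fun i : ℤ =>
      δ (y (Multiplicative.ofAdd i, h * g)) - ρ g⁻¹ * δ (y (Multiplicative.ofAdd i, h)) := by
    have hg : g ∈ Subgroup.closure S := hS ▸ Subgroup.mem_top g
    induction hg using Subgroup.closure_induction with
    | mem s hs => exact hrule s hs
    | one => simpa using IsFiniteCoboundary.zero
    | mul a b _ _ iha ihb =>
      intro h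
      convert (ihb (h * a)).add ((iha h).mul_left (ρ b⁻¹)) using 2
      rw [mul_inv_rev, map_mul, mul_assoc]
      noncomm_ring
    | inv a _ iha =>
      intro h
      convert (iha (h * a⁻¹)).mul_left (-ρ a) using 2
      have h1 : ρ a * ρ a⁻¹ = 1 := by rw [← map_mul, mul_inv_cancel, map_one]
      rw [mul_sub, neg_mul, neg_mul, ← mul_assoc, h1, inv_mul_cancel_right, inv_inv]
      noncomm_ring
  have hdiff (h h' : G) (hh : IsFiniteCoboundary fun i : ℤ =>
      δ (y (Multiplicative.ofAdd i, h)) - δ (y (Multiplicative.ofAdd i, h'))) : h = h' := by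
    refine inv_injective (hρ (sub_eq_zero.1 (hfree _ ?_)))
    convert (hh.add (hall h' 1)).add ((hall h 1).mul_left (-1)) using 2
    simp only [one_mul]
    noncomm_ring
  ext ⟨n, g⟩
  constructor
  · intro hstab
    have hy (i : ℤ) (h : G) :
        y (Multiplicative.ofAdd (i + -n.toAdd), g⁻¹ * h) = y (Multiplicative.ofAdd i, h) := by
      rw [← congrFun hstab (Multiplicative.ofAdd i, h), add_comm]
      rfl
    have hrange (h : G) : (Set.range fun i : ℤ => δ (y (Multiplicative.ofAdd i, h))).Finite :=
      (Set.finite_range δ).subset (by rintro _ ⟨i, rfl⟩; exact ⟨_, rfl⟩)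
    obtain rfl : g = 1 := by
      refine (inv_eq_one.1 (hdiff 1 g⁻¹ ?_).symm)
      convert IsFiniteCoboundary.translate_sub (hrange g⁻¹) (-n.toAdd) using 3
      rw [← hy, mul_one]
    suffices n.toAdd = 0 by
      have hn : n = 1 := this
      simp [hn]
    by_contra hn
    obtain ⟨h, h', hne, heq⟩ := Finite.exists_ne_map_eq_of_infinite
      fun (h : G) (r : Fin n.toAdd.natAbs) => y (Multiplicative.ofAdd (r : ℤ), h)
    have hmod (i : ℤ) (h : G) :
        y (Multiplicative.ofAdd (i % n.toAdd), h) = y (Multiplicative.ofAdd i, h) := by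
      have hper : Function.Periodic (fun i : ℤ => y (Multiplicative.ofAdd i, h)) (-n.toAdd) :=
        fun i => by simpa using hy i h
      have := hper.int_mul (i / n.toAdd) i
      rw [← this, Int.emod_def]
      congr 3
      simp only [Int.cast_id]
      ring
    refine hne (hdiff h h' ?_)
    convert IsFiniteCoboundary.zero (V := E) using 2 with i
    have hlt : (i % n.toAdd).toNat < n.toAdd.natAbs := by
      have := Int.emod_nonneg i hn
      have := Int.emod_lt_abs i hn
      rw [Int.abs_eq_natAbs] at this
      omega
    have := congrFun heq ⟨_, hlt⟩
    simp only [Int.toNat_of_nonneg (Int.emod_nonneg i hn), hmod] at this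
    rw [this, sub_self]
  · intro h
    obtain ⟨rfl, rfl⟩ := Prod.mk.inj (Set.mem_singleton_iff.1 h)
    change Shift 1 y = y
    funext γ
    simp [Shift]

namespace Matrix

variable {k : ℕ}

theorem linfty_opNorm_le_of_entry_le {A : Matrix (Fin k) (Fin k) ℚ} {b : ℝ} (hb : 0 ≤ b)
    (hA : ∀ i j, |(A i j : ℝ)| ≤ b) : ‖A‖ ≤ k * b := by
  lift b to NNReal using hb
  rw [linfty_opNorm_def, ← NNReal.coe_natCast, ← NNReal.coe_mul, NNReal.coe_le_coe]
  refine Finset.sup_le fun i _ => ?_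
  refine (Finset.sum_le_card_nsmul _ _ b fun j _ => ?_).trans (by simp)
  rw [← NNReal.coe_le_coe, coe_nnnorm, ← Rat.norm_cast_real]
  exact hA i j

theorem entry_le_linfty_opNorm (A : Matrix (Fin k) (Fin k) ℚ) (i j : Fin k) :
    |(A i j : ℝ)| ≤ ‖A‖ := by
  rw [← Real.norm_eq_abs, Rat.norm_cast_real, linfty_opNorm_def, ← coe_nnnorm,
    NNReal.coe_le_coe]
  exact (Finset.single_le_sum (f := fun j => ‖A i j‖₊) (fun _ _ => zero_le)
    (Finset.mem_univ j)).trans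
    (Finset.le_sup (f := fun i => ∑ j, ‖A i j‖₊) (Finset.mem_univ i))

/-- The rational matrices with integer entries. -/
def integral (k : ℕ) : Subring (Matrix (Fin k) (Fin k) ℚ) :=
  (Int.castRingHom ℚ).mapMatrix.range

theorem finite_integral_of_norm_le (D : ℕ) (hD : D ≠ 0) (b : ℝ) :
    {A : Matrix (Fin k) (Fin k) ℚ | ‖A‖ ≤ b ∧ (D : ℚ) • A ∈ integral k}.Finite := by
  have hfin : {t : ℚ | |(t : ℝ)| ≤ b ∧ ∃ z : ℤ, (D : ℚ) * t = z}.Finite := by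
    refine ((Set.finite_Icc (-⌈D * b⌉) ⌈D * b⌉).image fun z : ℤ => (z : ℚ) / D).subset ?_
    rintro t ⟨ht, z, hz⟩
    have hz' : (D : ℝ) * t = z := by exact_mod_cast hz
    have hle : |(z : ℝ)| ≤ ⌈D * b⌉ := by
      rw [← hz', abs_mul, Nat.abs_cast]
      exact (mul_le_mul_of_nonneg_left ht (Nat.cast_nonneg D)).trans (Int.le_ceil _)
    refine ⟨z, ?_, ?_⟩
    · have := abs_le.1 hle
      exact ⟨by exact_mod_cast this.1, by exact_mod_cast this.2⟩
    · simp only [← hz]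
      field_simp
  refine (Set.Finite.pi' fun _ => Set.Finite.pi' fun _ => hfin).subset ?_
  rintro A ⟨hA, Z, hZ⟩ i j
  refine ⟨(entry_le_linfty_opNorm A i j).trans hA, Z i j, ?_⟩
  exact (congrFun (congrFun hZ i) j).symm

theorem exists_smul_mem_integral (A : Matrix (Fin k) (Fin k) ℚ) :
    ∃ D : ℕ, D ≠ 0 ∧ (D : ℚ) • A ∈ integral k := by
  refine ⟨∏ p : Fin k × Fin k, (A p.1 p.2).den,
    Finset.prod_ne_zero_iff.2 fun p _ => (A p.1 p.2).den_nz, ?_⟩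
  have hz (i j : Fin k) :
      ∃ z : ℤ, (z : ℚ) = ((∏ p : Fin k × Fin k, (A p.1 p.2).den : ℕ) : ℚ) * A i j := by
    obtain ⟨d, hd⟩ := Finset.dvd_prod_of_mem (fun p : Fin k × Fin k => (A p.1 p.2).den)
      (Finset.mem_univ (i, j))
    refine ⟨(A i j).num * d, ?_⟩
    rw [hd]
    push_cast
    rw [mul_right_comm, mul_comm ((A i j).den : ℚ), Rat.mul_den_eq_num]
  choose z hz using hz
  refine ⟨Matrix.of z, ?_⟩
  ext i j
  simp [hz]

/-- The entrywise floor of a rational matrix. -/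
def floor (A : Matrix (Fin k) (Fin k) ℚ) : Matrix (Fin k) (Fin k) ℚ :=
  A.map fun t => (⌊t⌋ : ℚ)

theorem floor_mem_integral (A : Matrix (Fin k) (Fin k) ℚ) : floor A ∈ integral k :=
  ⟨A.map fun t => ⌊t⌋, by ext; simp [floor]⟩

theorem norm_floor_sub_le (A : Matrix (Fin k) (Fin k) ℚ) : ‖floor A - A‖ ≤ k := by
  rw [← mul_one (k : ℝ)]
  refine linfty_opNorm_le_of_entry_le zero_le_one fun i j => ?_
  rw [abs_le]
  have h1 := Int.floor_le (A i j)
  have h2 := Int.lt_floor_add_one (A i j)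
  have h3 : (-1 : ℚ) ≤ ⌊A i j⌋ - A i j := by linarith
  have h4 : (⌊A i j⌋ - A i j : ℚ) ≤ 1 := by linarith
  simp only [floor, sub_apply, map_apply]
  exact ⟨by exact_mod_cast h3, by exact_mod_cast h4⟩

end Matrix

/-- If `G` is an infinite finitely generated subgroup of `GL_k(ℚ)` whose image in
`GL_k(ℝ)` is bounded (all matrix entries of elements of `G` are bounded in absolute
value), then there is a strongly aperiodic SFT on `Γ = ℤ × G`: a nonempty finite alphabet
`Fin m` and a finite set `L` of patterns over `Γ` whose SFT `X` is nonempty with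
`Stab(x) = {1}` for every `x ∈ X`. -/
theorem stmt_19 (k : ℕ) (G : Subgroup (GL (Fin k) ℚ)) [Infinite G]
    (hfg : Group.FG G)
    (hbdd : ∃ M : ℝ, ∀ g : G, ∀ i j : Fin k,
      |(((g : GL (Fin k) ℚ) : Matrix (Fin k) (Fin k) ℚ) i j : ℝ)| ≤ M) :
    ∃ (m : ℕ) (_ : 0 < m)
      (L : Set (Finset (Multiplicative ℤ × G) × ((Multiplicative ℤ × G) → Fin m))),
      L.Finite ∧ (SFT L).Nonempty ∧
        ∀ x ∈ SFT L, Stab x = ({1} : Set (Multiplicative ℤ × G)) := by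
  classical
  obtain ⟨M, hM⟩ := hbdd
  obtain ⟨S, hS⟩ := Group.fg_def.1 hfg
  let ρ : G →* Matrix (Fin k) (Fin k) ℚ := (Units.coeHom _).comp G.subtype
  have hρ : Function.Injective ρ := Units.val_injective.comp Subtype.val_injective
  have hρK (g : G) : ‖ρ g‖ ≤ k * |M| := Matrix.linfty_opNorm_le_of_entry_le (abs_nonneg M)
    fun i j => (hM g i j).trans (le_abs_self M)
  set K : ℝ := k * |M|
  have hK : 0 ≤ K := by positivity
  obtain ⟨q, hq⟩ := exists_nat_gt (K * (4 * k))
  let B (h : G) : Matrix (Fin k) (Fin k) ℚ := (q : Matrix (Fin k) (Fin k) ℚ) * ρ h⁻¹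
  have hB (h s : G) : B (h * s) = ρ s⁻¹ * B h := by
    simp only [B, mul_inv_rev, map_mul]
    rw [← mul_assoc, ← mul_assoc, (Nat.cast_commute q (ρ s⁻¹)).eq]
  have hBnorm (h : G) : ‖B h‖ ≤ q * K := by
    have : B h = (q : ℚ) • ρ h⁻¹ := by
      rw [Nat.cast_smul_eq_nsmul, nsmul_eq_mul]
    rw [this, norm_smul, ← Rat.norm_cast_real]
    simpa using mul_le_mul_of_nonneg_left (hρK h⁻¹) (Nat.cast_nonneg q)
  -- The symbols are triples (label of the row, digit, carries).
  let label (h : G) := (B h).floor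
  let digit (i : ℤ) (h : G) :=
    (((i + 1 : ℤ) : ℚ) • B h).floor - ((i : ℚ) • B h).floor
  let carry (i : ℤ) (h : G) (s : S) :=
    ρ (s : G)⁻¹ * ((i : ℚ) • B h).floor - ((i : ℚ) • B (h * s)).floor
  have hlabel (h : G) : ‖label h - B h‖ ≤ k := Matrix.norm_floor_sub_le _
  have hdigit (i : ℤ) (h : G) : ‖digit i h - label h‖ ≤ 3 * k := by
    have h1 : digit i h - label h =
        ((((i + 1 : ℤ) : ℚ) • B h).floor - (((i + 1 : ℤ) : ℚ) • B h))
        - (((i : ℚ) • B h).floor - (i : ℚ) • B h) - (label h - B h) := by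
      simp only [digit]
      push_cast
      module
    rw [h1]
    refine (norm_sub_le_of_le (norm_sub_le_of_le (Matrix.norm_floor_sub_le _)
      (Matrix.norm_floor_sub_le _)) (hlabel h)).trans ?_
    linarith
  have hcarry (i : ℤ) (h : G) (s : S) : ‖carry i h s‖ ≤ K * k + k := by
    have h1 : carry i h s = ρ (s : G)⁻¹ * (((i : ℚ) • B h).floor - (i : ℚ) • B h)
        - (((i : ℚ) • B (h * s)).floor - (i : ℚ) • B (h * s)) := by
      simp only [carry]
      rw [hB, mul_sub, mul_smul_comm]
      abel
    rw [h1]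
    refine norm_sub_le_of_le ((norm_mul_le _ _).trans ?_) (Matrix.norm_floor_sub_le _)
    exact mul_le_mul (hρK _) (Matrix.norm_floor_sub_le _) (norm_nonneg _) hK
  have hrule (i : ℤ) (h : G) (s : S) :
      digit i (h * s) = ρ (s : G)⁻¹ * digit i h + carry i h s - carry (i + 1) h s := by
    simp only [digit, carry]
    noncomm_ring
  let x₀ (γ : Multiplicative ℤ × G) : Matrix (Fin k) (Fin k) ℚ × Matrix (Fin k) (Fin k) ℚ ×
      (S → Matrix (Fin k) (Fin k) ℚ) :=
    (label γ.2, digit γ.1.toAdd γ.2, carry γ.1.toAdd γ.2)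
  have hfin : (Set.range x₀).Finite := by
    choose D hD hDint using fun s : S => Matrix.exists_smul_mem_integral (ρ (s : G)⁻¹)
    refine ((Matrix.finite_integral_of_norm_le 1 one_ne_zero (k + q * K)).prod
      ((Matrix.finite_integral_of_norm_le 1 one_ne_zero (3 * k + (k + q * K))).prod
      (Set.Finite.pi' fun s =>
        Matrix.finite_integral_of_norm_le (D s) (hD s) (K * k + k)))).subset ?_
    rintro _ ⟨⟨i, h⟩, rfl⟩
    have h1 : ‖label h‖ ≤ k + q * K := by
      simpa using norm_add_le_of_le (hlabel h) (hBnorm h)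
    refine ⟨⟨h1, ?_⟩, ⟨?_, ?_⟩, fun s => ⟨hcarry _ _ _, ?_⟩⟩
    · simpa using Matrix.floor_mem_integral _
    · simpa using norm_add_le_of_le (hdigit i.toAdd h) h1
    · simpa using sub_mem (Matrix.floor_mem_integral _) (Matrix.floor_mem_integral _)
    · simp only [x₀, carry]
      rw [smul_sub, ← smul_mul_assoc, Nat.cast_smul_eq_nsmul ℚ _ (Matrix.floor _), nsmul_eq_mul]
      exact sub_mem (mul_mem (hDint s) (Matrix.floor_mem_integral _))
        (mul_mem (natCast_mem _ _) (Matrix.floor_mem_integral _))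
  have : Finite (Set.range x₀) := hfin
  let P (y : Multiplicative ℤ × G → Set.range x₀) : Prop :=
    (y (Multiplicative.ofAdd 1, 1)).1.1 = (y (1, 1)).1.1 ∧
    ∀ s : S, (y (1, s)).1.2.1 = ρ (s : G)⁻¹ * (y (1, 1)).1.2.1 + (y (1, 1)).1.2.2 s
      - (y (Multiplicative.ofAdd 1, 1)).1.2.2 s
  let F : Finset (Multiplicative ℤ × G) :=
    {(1, 1), (Multiplicative.ofAdd 1, 1)} ∪ S.image fun s => (1, s)
  obtain ⟨m, hm, e, L, hL, hSFT⟩ := exists_sft_of_local_rule F P (by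
    intro y y' hyy hy
    have h1 := hyy (1, 1) (by simp [F])
    have h2 := hyy (Multiplicative.ofAdd 1, 1) (by simp [F])
    have h3 (s : S) := hyy (1, s) (by simp [F])
    simpa only [P, h1, h2, h3] using hy)
  refine ⟨m, hm, L, hL, ⟨e ∘ fun γ => ⟨x₀ γ, γ, rfl⟩, (hSFT _).2 fun g => ⟨?_, fun s => ?_⟩⟩, ?_⟩
  · simp [Shift, x₀]
  · have := hrule (g.1⁻¹).toAdd g.2⁻¹ s
    simpa [Shift, x₀] using this
  · intro x hx
    obtain ⟨y, rfl⟩ : ∃ y, x = e ∘ y := ⟨e.symm ∘ x, by ext; simp⟩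
    rw [stab_equiv_comp]
    rw [hSFT] at hx
    have hx' (i : ℤ) (h : G) := hx (Multiplicative.ofAdd i, h)⁻¹
    simp only [P, Shift, inv_inv, Prod.mk_mul_mk, mul_one, ← ofAdd_add] at hx'
    refine stab_eq_one_of_isFiniteCoboundary ρ hρ hS (fun a => a.1.2.1) y ?_ ?_
    · intro s hs h
      refine ⟨fun i => -(y (Multiplicative.ofAdd i, h)).1.2.2 ⟨s, hs⟩, ?_, fun i => ?_⟩
      · exact (Set.finite_range fun a : Set.range x₀ => -a.1.2.2 ⟨s, hs⟩).subset
          (by rintro _ ⟨i, rfl⟩; exact ⟨_, rfl⟩)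
      · have h1 := (hx' i h).2 ⟨s, hs⟩
        simp only at h1 ⊢
        rw [h1]
        abel
    · intro R hR
      obtain ⟨⟨_, h⟩, hh⟩ := (y (Multiplicative.ofAdd 0, 1)).2
      have hconst (i : ℤ) : (y (Multiplicative.ofAdd i, 1)).1.1 = label h := by
        induction i using Int.induction_on with
        | zero => rw [← hh]
        | succ i ih => rw [(hx' i 1).1, ih]
        | pred i ih => rw [← ih, ← (hx' (-i - 1) 1).1, sub_add_cancel]
      refine eq_zero_of_isFiniteCoboundary_mul (m := ρ h⁻¹) (m' := ρ h) (b := 4 * k)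
        (by simp [← map_mul]) (hρK h) hq (fun i => ?_) hR
      obtain ⟨⟨j, h'⟩, hh'⟩ := (y (Multiplicative.ofAdd i, 1)).2
      have h1 : label h' = label h := by rw [← hconst i, ← hh']
      have h2 := norm_add_le_of_le (h1 ▸ hdigit j.toAdd h') (hlabel h)
      rw [sub_add_sub_cancel] at h2
      rw [← hh']
      exact h2.trans (by linarith)
end
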